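/- Let A be a minimal generic set on a property C of finitely generated squarefree monomial ideals of S_∞ = K[x_1, x_2, …]. If I', I ∈ A satisfy μ(I') = μ(I) and H(I') ⊆ H(I) (i.e., there is a bijection σ from the vertex set of H(I') to the vertex set of H(I) with σ(F) ∈ H(I) for every face F ∈ H(I')), then I' = I. -/

import Mathlib

open CategoryTheory MvPolynomial

universe u

variable (K : Type u) [Field K]

/-- The squarefree monomial with support `A` in `K[x_0, x_1, …]`. -/
noncomputable def sqfMon (A : Finset ℕ) : MvPolynomial ℕ K :=
  ∏ i ∈ A, X i

/-- `I` is a finitely generated squarefree monomial ideal of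
`S_∞ = K[x_0, x_1, …]`. -/
def IsFGSqfMonIdeal (I : Ideal (MvPolynomial ℕ K)) : Prop :=
  ∃ 𝒜 : Finset (Finset ℕ), I = Ideal.span ((fun A => sqfMon K A) '' ↑𝒜)

/-- The supports of the minimal monomial generators `G(I)` of a squarefree
monomial ideal `I`. -/
def minSupp (I : Ideal (MvPolynomial ℕ K)) : Set (Finset ℕ) :=
  {A | sqfMon K A ∈ I ∧ ∀ B : Finset ℕ, B ⊂ A → sqfMon K B ∉ I}

/-- `μ(I)`: the number of minimal monomial generators. -/
noncomputable def muI (I : Ideal (MvPolynomial ℕ K)) : ℕ :=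
  (minSupp K I).ncard

/-- `X(I)`: the set of variables appearing in the minimal monomial
generators of `I`. -/
def varSet (I : Ideal (MvPolynomial ℕ K)) : Set ℕ :=
  ⋃ A ∈ minSupp K I, (↑A : Set ℕ)

/-- The hypergraph `H(I)`, with vertex set `G(I)` (identified with the set
`minSupp K I` of supports of minimal generators): faces are the nonempty
sets of generators divisible by a fixed variable. -/
def hypI (I : Ideal (MvPolynomial ℕ K)) : Set (Set (Finset ℕ)) :=
  {F | F.Nonempty ∧ ∃ x : ℕ, F = {A ∈ minSupp K I | x ∈ A}}

/-- The relation of Definition 5.1(2): the ideal `J` is obtained from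
`I ∈ 𝒜` by substituting pairwise coprime squarefree monomials `M x` (in the
variables `X(J)`, possibly trivial) for the variables `x ∈ X(I)`; on supports
this means a bijection `σ` of `G(I)` with `G(J)` such that the support of
`σ A` is the disjoint union of the `M x`, `x ∈ A`. -/
def Connects (I J : Ideal (MvPolynomial ℕ K)) : Prop :=
  ∃ (σ : Finset ℕ → Finset ℕ) (M : ℕ → Finset ℕ),
    Set.BijOn σ (minSupp K I) (minSupp K J) ∧
    (∀ x ∈ varSet K I, ∀ y ∈ varSet K I, x ≠ y → Disjoint (M x) (M y)) ∧
    (∀ x ∈ varSet K I, (↑(M x) : Set ℕ) ⊆ varSet K J) ∧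
    (∀ A ∈ minSupp K I, σ A = A.biUnion M)

/-- `𝒜` is a generic set on the property `C` (a set of ideals): every member
is a finitely generated squarefree monomial ideal satisfying `C`, and every
finitely generated squarefree monomial ideal satisfying `C` arises from some
member of `𝒜` by the substitution relation `Connects`. -/
def IsGenericSet (C 𝒜 : Set (Ideal (MvPolynomial ℕ K))) : Prop :=
  (∀ I ∈ 𝒜, IsFGSqfMonIdeal K I ∧ I ∈ C) ∧
  (∀ J, IsFGSqfMonIdeal K J → J ∈ C → ∃ I ∈ 𝒜, Connects K I J)

/-- A generic set is minimal if no proper subset is a generic set. -/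
def IsMinimalGenericSet (C 𝒜 : Set (Ideal (MvPolynomial ℕ K))) : Prop :=
  IsGenericSet K C 𝒜 ∧ ∀ 𝒜' ⊆ 𝒜, IsGenericSet K C 𝒜' → 𝒜' = 𝒜

variable {K}

theorem sqfMon_eq_monomial (A : Finset ℕ) :
    sqfMon K A = monomial (∑ i ∈ A, Finsupp.single i 1) 1 := by
  rw [monomial_sum_one]
  rfl

theorem minSupp_finite {I : Ideal (MvPolynomial ℕ K)} (hI : IsFGSqfMonIdeal K I) :
    (minSupp K I).Finite := by
  obtain ⟨S, rfl⟩ := hI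
  refine S.finite_toSet.subset ?_
  rintro A ⟨hA, hmin⟩
  have himg : (fun B => sqfMon K B) '' (S : Set (Finset ℕ)) =
      (fun e => monomial e (1 : K)) ''
        ((fun B : Finset ℕ => ∑ i ∈ B, Finsupp.single i 1) '' (S : Set (Finset ℕ))) := by
    rw [Set.image_image]
    exact Set.image_congr fun B _ => sqfMon_eq_monomial B
  have hmem := hA
  rw [himg, mem_ideal_span_monomial_image, sqfMon_eq_monomial] at hmem
  obtain ⟨_, ⟨B, hB, rfl⟩, hle⟩ := hmem (∑ i ∈ A, Finsupp.single i 1) (by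
    classical
    rw [mem_support_iff, coeff_monomial, if_pos rfl]
    exact one_ne_zero)
  have hBA : B ⊆ A := by
    intro i hi
    by_contra hiA
    have := hle i
    simp [Finsupp.finsetSum_apply, Finsupp.single_apply, hi, hiA] at this
  rcases hBA.eq_or_ssubset with rfl | hss
  · exact hB
  · exact absurd (Ideal.subset_span (Set.mem_image_of_mem _ hB)) (hmin B hss)

theorem mem_varSet_iff {I : Ideal (MvPolynomial ℕ K)} {x : ℕ} :
    x ∈ varSet K I ↔ ∃ A ∈ minSupp K I, x ∈ A := by
  simp [varSet]

theorem varSet_finite {I : Ideal (MvPolynomial ℕ K)} (hI : IsFGSqfMonIdeal K I) :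
    (varSet K I).Finite :=
  (minSupp_finite hI).biUnion fun A _ => A.finite_toSet

theorem Connects.trans {I J L : Ideal (MvPolynomial ℕ K)} (hIJ : Connects K I J)
    (hJL : Connects K J L) : Connects K I L := by
  obtain ⟨σ, M, hσ, hdisj, hsub, hprod⟩ := hIJ
  obtain ⟨τ, N, hτ, hdisj', hsub', hprod'⟩ := hJL
  refine ⟨τ ∘ σ, fun x => (M x).biUnion N, hτ.comp hσ, ?_, ?_, ?_⟩
  · intro x hx y hy hxy
    rw [Finset.disjoint_biUnion_left]
    intro a ha
    rw [Finset.disjoint_biUnion_right]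
    intro b hb
    exact hdisj' a (hsub x hx ha) b (hsub y hy hb) fun hab =>
      Finset.disjoint_left.mp (hdisj x hx y hy hxy) ha (hab ▸ hb)
  · intro x hx z hz
    obtain ⟨a, ha, hza⟩ := Finset.mem_biUnion.mp hz
    exact hsub' a (hsub x hx ha) hza
  · intro A hA
    rw [Function.comp_apply, hprod' _ (hσ.mapsTo hA), hprod A hA, Finset.biUnion_biUnion]

/-- An inclusion of hypergraphs `H(J) ⊆ H(I)` lets one substitute for each variable of `I` the
product of the variables of `J` assigned to it by the inclusion, which recovers `J`. -/
theorem connects_of_hypI_inclusion {I J : Ideal (MvPolynomial ℕ K)} (hJ : IsFGSqfMonIdeal K J)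
    {σ : Finset ℕ → Finset ℕ} (hσ : Set.BijOn σ (minSupp K J) (minSupp K I))
    (hface : ∀ F ∈ hypI K J, σ '' F ∈ hypI K I) : Connects K I J := by
  classical
  have hexists : ∀ y ∈ varSet K J, ∃ x, σ '' {A ∈ minSupp K J | y ∈ A} =
      {A ∈ minSupp K I | x ∈ A} := by
    intro y hy
    obtain ⟨A, hA, hyA⟩ := mem_varSet_iff.mp hy
    exact (hface {A ∈ minSupp K J | y ∈ A} ⟨⟨A, hA, hyA⟩, y, rfl⟩).2
  choose! f hf using hexists
  have hinv := hσ.invOn_invFunOn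
  have hτ := hσ.symm hinv.symm
  refine ⟨Function.invFunOn σ (minSupp K J),
    fun x => (varSet_finite hJ).toFinset.filter (f · = x), hτ, ?_, ?_, ?_⟩
  · intro x _ y _ hxy
    rw [Finset.disjoint_left]
    intro z hz hz'
    exact hxy ((Finset.mem_filter.mp hz).2.symm.trans (Finset.mem_filter.mp hz').2)
  · intro x _ z hz
    exact (varSet_finite hJ).mem_toFinset.mp (Finset.mem_filter.mp hz).1
  · intro A hA
    have hB := hτ.mapsTo hA
    have hBA := hinv.2 hA
    set B := Function.invFunOn σ (minSupp K J) A
    ext y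
    simp only [Finset.mem_biUnion, Finset.mem_filter, Set.Finite.mem_toFinset]
    constructor
    · intro hy
      have hyJ : y ∈ varSet K J := mem_varSet_iff.mpr ⟨B, hB, hy⟩
      have hAf : A ∈ {A ∈ minSupp K I | f y ∈ A} := hf y hyJ ▸ ⟨B, ⟨hB, hy⟩, hBA⟩
      exact ⟨f y, hAf.2, hyJ, rfl⟩
    · rintro ⟨_, hfy, hyJ, rfl⟩
      have hAσ : A ∈ σ '' {A ∈ minSupp K J | y ∈ A} := (hf y hyJ).symm ▸ ⟨hA, hfy⟩
      obtain ⟨B', ⟨hB', hy⟩, hσB'⟩ := hAσ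
      rwa [hσ.injOn hB hB' (hBA.trans hσB'.symm)]

theorem IsMinimalGenericSet.eq_of_connects {C 𝒜 : Set (Ideal (MvPolynomial ℕ K))}
    (h : IsMinimalGenericSet K C 𝒜) {I J : Ideal (MvPolynomial ℕ K)} (hI : I ∈ 𝒜) (hJ : J ∈ 𝒜)
    (hIJ : Connects K I J) : J = I := by
  by_contra hne
  have hgen : IsGenericSet K C (𝒜 \ {J}) := by
    refine ⟨fun L hL => h.1.1 L hL.1, fun L hL hLC => ?_⟩
    obtain ⟨N, hN, hNL⟩ := h.1.2 L hL hLC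
    by_cases hNJ : N = J
    · exact ⟨I, ⟨hI, fun hIJ' => hne hIJ'.symm⟩, hIJ.trans (hNJ ▸ hNL)⟩
    · exact ⟨N, ⟨hN, hNJ⟩, hNL⟩
  have hJ' : J ∈ 𝒜 \ {J} := (h.2 _ Set.sdiff_subset hgen).symm ▸ hJ
  exact hJ'.2 rfl

variable (K)

/-!
Statement 12 (Proposition `claim:GenSet`(2)): if `𝒜` is a minimal generic set
on a property `C` and `I', I ∈ 𝒜` satisfy `μ(I') = μ(I)` and `H(I') ⊆ H(I)`
(via a bijection `σ` of vertex sets carrying faces to faces), then `I' = I`.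
-/

theorem minimal_generic_set_no_hypergraph_inclusion
    (C 𝒜 : Set (Ideal (MvPolynomial ℕ K)))
    (h : IsMinimalGenericSet K C 𝒜)
    (I' I : Ideal (MvPolynomial ℕ K)) (hI' : I' ∈ 𝒜) (hI : I ∈ 𝒜)
    (hmu : muI K I' = muI K I)
    (σ : Finset ℕ → Finset ℕ)
    (hbij : Set.BijOn σ (minSupp K I') (minSupp K I))
    (hface : ∀ F ∈ hypI K I', σ '' F ∈ hypI K I) :
    I' = I := by
  exact h.eq_of_connects hI hI' (connects_of_hypI_inclusion (h.1.1 I' hI').1 hbij hface)
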